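/- Let (x₀,…,x_{k+2}; y₀,…,y_{k+1}; z₀,…,z_k), k ≥ 0, be nonnegative integers satisfying x_j ≥ y_j > x_{j+1} for 0 ≤ j ≤ k+1 and y_j > z_j ≥ y_{j+1} for 0 ≤ j ≤ k (a Δ-then-Γ short pattern), and let y'_j be defined by y'₀ = x₀ + max(x₁, z₀) − y₀, y'_j = min(x_j, z_{j−1}) + max(x_{j+1}, z_j) − y_j for 1 ≤ j ≤ k, and y'_{k+1} = min(x_{k+1}, z_k) + x_{k+2} − y_{k+1}. Fix 0 ≤ i ≤ k and assume that x_i = y_i or (i ≥ 1 and z_{i−1} = y_i). Then: (1) if x_{i+1} = y_{i+1} and z_i = y_{i+1}, then y'_i = x_{i+1} and y'_i = z_i; (2) if x_{i+1} = y_{i+1} and z_i ≠ y_{i+1}, then y'_i = z_i and y'_i ≠ x_{i+1}; (3) if z_i = y_{i+1} and x_{i+1} ≠ y_{i+1}, then y'_i = x_{i+1} and y'_i ≠ z_i. -/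

import Mathlib

namespace ShortPattern

/-- The middle row of `t_short 𝔱` for a short pattern with rows
`(x₀,…,x_{k+2}; y₀,…,y_{k+1}; z₀,…,z_k)`. -/
def tshort (k : ℕ) (x y z : ℕ → ℕ) : ℕ → ℕ := fun j =>
  if j = 0 then x 0 + max (x 1) (z 0) - y 0
  else if j = k + 1 then min (x (k + 1)) (z k) + x (k + 2) - y (k + 1)
  else min (x j) (z (j - 1)) + max (x (j + 1)) (z j) - y j

/-- Inside a block, the reflected middle row is the maximum of its two right-hand neighbours. -/
theorem tshort_eq_max_of_block (k : ℕ) (x y z : ℕ → ℕ)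
    (hxy : ∀ j, j ≤ k + 1 → x j ≥ y j) (hyz : ∀ j, j ≤ k → z j ≥ y (j + 1))
    (i : ℕ) (hik : i ≤ k) (hblock : x i = y i ∨ (1 ≤ i ∧ z (i - 1) = y i)) :
    tshort k x y z i = max (x (i + 1)) (z i) := by
  have hx := hxy i (by omega)
  rcases i with _ | i
  · simp only [tshort, if_true, zero_add]
    omega
  · have hz := hyz i (by omega)
    rw [Nat.add_sub_cancel] at hblock
    simp only [tshort, Nat.add_sub_cancel]
    rw [if_neg (by omega), if_neg (by omega)]
    omega

/-- Relating the equality (highlighting) pattern at column `i+1` of a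
Δ-then-Γ short pattern to the one at column `i` of its middle-row reflection, inside a block. -/
theorem highlight_transfer (k : ℕ) (x y z : ℕ → ℕ)
    (hxy : ∀ j, j ≤ k + 1 → x j ≥ y j ∧ y j > x (j + 1))
    (hyz : ∀ j, j ≤ k → y j > z j ∧ z j ≥ y (j + 1))
    (i : ℕ) (hik : i ≤ k)
    (hblock : x i = y i ∨ (1 ≤ i ∧ z (i - 1) = y i)) :
    (x (i + 1) = y (i + 1) ∧ z i = y (i + 1) →
      tshort k x y z i = x (i + 1) ∧ tshort k x y z i = z i) ∧
    (x (i + 1) = y (i + 1) ∧ z i ≠ y (i + 1) →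
      tshort k x y z i = z i ∧ tshort k x y z i ≠ x (i + 1)) ∧
    (z i = y (i + 1) ∧ x (i + 1) ≠ y (i + 1) →
      tshort k x y z i = x (i + 1) ∧ tshort k x y z i ≠ z i) := by
  rw [tshort_eq_max_of_block k x y z (fun j hj => (hxy j hj).1)
    (fun j hj => (hyz j hj).2) i hik hblock]
  have hx := (hxy (i + 1) (by omega)).1
  have hz := (hyz i hik).2
  omega

end ShortPattern
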